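/- Let μ > 0 and let X and Y be polygonal curves in ℝ^d; let X̂ = simpl(X,μ) and Ŷ = simpl(Y,μ) be their μ-simplifications. Then for every k ∈ ℕ, d_S^k(X̂,Ŷ) − 2μ ≤ d_S^k(X,Y) ≤ d_S^k(X̂,Ŷ) + 2μ; similarly, for the unbounded version, d_S(X̂,Ŷ) − 2μ ≤ d_S(X,Y) ≤ d_S(X̂,Ŷ) + 2μ. -/

import Mathlib

open Set

noncomputable section

namespace Jaywalk

variable {d : ℕ}

/-- An orientation-preserving reparameterization of `[0,1]`: a continuous, strictly
increasing bijection of `[0,1]` onto itself with `f 0 = 0` and `f 1 = 1`. -/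
structure IsReparam (f : ℝ → ℝ) : Prop where
  contOn : ContinuousOn f (Icc 0 1)
  strictMonoOn : StrictMonoOn f (Icc 0 1)
  mapsTo : MapsTo f (Icc 0 1) (Icc 0 1)
  surjOn : SurjOn f (Icc 0 1) (Icc 0 1)
  map_zero : f 0 = 0
  map_one : f 1 = 1

/-- The width of a reparameterization `f` with respect to curves `X Y : [0,1] → ℝ^d`. -/
def frechetWidth (X Y : ℝ → EuclideanSpace ℝ (Fin d)) (f : ℝ → ℝ) : ℝ :=
  ⨆ t : Icc (0:ℝ) 1, ‖X (f ↑t) - Y ↑t‖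

/-- The Fréchet distance between two curves `X Y : [0,1] → ℝ^d`. -/
def frechetDist (X Y : ℝ → EuclideanSpace ℝ (Fin d)) : ℝ :=
  sInf {w | ∃ f, IsReparam f ∧ w = frechetWidth X Y f}

/-- The segment from `p` to `q`, as a curve `t ↦ (1-t)·p + t·q`. -/
def seg (p q : EuclideanSpace ℝ (Fin d)) : ℝ → EuclideanSpace ℝ (Fin d) :=
  fun t => (1 - t) • p + t • q

/-- The subcurve `Z[s,t]`, affinely reparameterized over `[0,1]`. -/
def subcurve (Z : ℝ → EuclideanSpace ℝ (Fin d)) (s t : ℝ) : ℝ → EuclideanSpace ℝ (Fin d) :=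
  fun τ => Z (s + τ * (t - s))

/-- Vertices extended to all of `ℕ` (clamped at `n`). -/
def vtx {n : ℕ} (v : Fin (n+1) → EuclideanSpace ℝ (Fin d)) (i : ℕ) :
    EuclideanSpace ℝ (Fin d) :=
  v ⟨min i n, Nat.lt_succ_of_le (min_le_right i n)⟩

/-- The uniformly parameterized polygonal curve through the vertices `v 0, …, v n`. -/
def polyCurve {n : ℕ} (v : Fin (n+1) → EuclideanSpace ℝ (Fin d)) :
    ℝ → EuclideanSpace ℝ (Fin d) :=
  fun t =>
    (1 - (t * n - ⌊t * n⌋₊)) • vtx v ⌊t * n⌋₊ + (t * n - ⌊t * n⌋₊) • vtx v (⌊t * n⌋₊ + 1)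

/-- Concatenation of two curves (sharing an endpoint). -/
def concat (A B : ℝ → EuclideanSpace ℝ (Fin d)) : ℝ → EuclideanSpace ℝ (Fin d) :=
  fun t => if t ≤ 1/2 then A (2 * t) else B (2 * t - 1)

/-- Concatenation of a finite list of curves. -/
def concatList : List (ℝ → EuclideanSpace ℝ (Fin d)) → ℝ → EuclideanSpace ℝ (Fin d)
  | [] => fun _ => 0
  | [A] => A
  | A :: B :: rest => concat A (concatList (B :: rest))

/-- Given curves `X Y`, the price of the tunnel from `a` to `b` (points of `[0,1]²`):
the Fréchet distance between the subcurve `X[a.1, b.1]` and the segment from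
`Y a.2` to `Y b.2`. -/
def tunnelPrice (X Y : ℝ → EuclideanSpace ℝ (Fin d)) (a b : ℝ × ℝ) : ℝ :=
  frechetDist (subcurve X a.1 b.1) (seg (Y a.2) (Y b.2))

open Classical in
/-- Indices of marked vertices in the greedy `μ`-simplification of the polygonal curve with
vertices `v 0, …, v n`:  start at vertex `0`; repeatedly jump to the first later vertex at
distance at least `μ` from the current one; finally also mark the last vertex `n`
(the sequence stabilizes at `n`). -/
def simplIdx (v : ℕ → EuclideanSpace ℝ (Fin d)) (μ : ℝ) (n : ℕ) : ℕ → ℕ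
  | 0 => 0
  | k+1 =>
    if h : ∃ j, simplIdx v μ n k < j ∧ j ≤ n ∧ μ ≤ ‖v j - v (simplIdx v μ n k)‖
    then Nat.find h
    else n

/-- The vertices of the `μ`-simplification (with the final vertex repeated). -/
def simplVerts {n : ℕ} (v : Fin (n+1) → EuclideanSpace ℝ (Fin d)) (μ : ℝ) :
    Fin (n+1) → EuclideanSpace ℝ (Fin d) :=
  fun k => vtx v (simplIdx (vtx v) μ n k.val)

/-- The `μ`-simplification `simpl(X, μ)` of the polygonal curve with vertices
`v 0, …, v n`: the polygonal curve through the marked vertices, in order. -/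
def simpl {n : ℕ} (v : Fin (n+1) → EuclideanSpace ℝ (Fin d)) (μ : ℝ) :
    ℝ → EuclideanSpace ℝ (Fin d) :=
  polyCurve (simplVerts v μ)

/-- `y` is the parameter of a vertex of a (uniformly parameterized) polygonal curve
with `n` edges. -/
def vertexParam (n : ℕ) (y : ℝ) : Prop := ∃ i : Fin (n+1), y = ((i : ℕ) : ℝ) / n

/-- The shortcut curve of `Y` determined by the list of shortcut parameter pairs,
starting from parameter `a`. -/
def shortcutFrom (Y : ℝ → EuclideanSpace ℝ (Fin d)) :
    List (ℝ × ℝ) → ℝ → ℝ → EuclideanSpace ℝ (Fin d)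
  | [], a => subcurve Y a 1
  | (y₁, y₂) :: rest, a =>
      concat (subcurve Y a y₁) (concat (seg (Y y₁) (Y y₂)) (shortcutFrom Y rest y₂))

/-- The shortcut parameter pairs form a nondecreasing sequence inside `[0,1]` and all
parameters are vertices of the polygonal curve with `n` edges. -/
def ValidShortcuts (n : ℕ) (L : List (ℝ × ℝ)) : Prop :=
  List.Chain' (· ≤ ·) ((0:ℝ) :: (L.flatMap fun p => [p.1, p.2]) ++ [1]) ∧
  ∀ p ∈ L, vertexParam n p.1 ∧ vertexParam n p.2

/-- The directed vertex-restricted `k`-shortcut Fréchet distance between a curve `X` and the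
polygonal curve with vertices `w 0, …, w n`: the infimum of the Fréchet distance between `X`
and any vertex-restricted shortcut curve of `polyCurve w` with at most `k` shortcuts. -/
def shortcutFrechetDist {n : ℕ} (X : ℝ → EuclideanSpace ℝ (Fin d))
    (w : Fin (n+1) → EuclideanSpace ℝ (Fin d)) (k : ℕ) : ℝ :=
  sInf {r | ∃ L : List (ℝ × ℝ), L.length ≤ k ∧ ValidShortcuts n L ∧
    r = frechetDist X (shortcutFrom (polyCurve w) L 0)}

/-- The directed vertex-restricted shortcut Fréchet distance (unbounded number of
shortcuts). -/
def shortcutFrechetDistUnbounded {n : ℕ} (X : ℝ → EuclideanSpace ℝ (Fin d))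
    (w : Fin (n+1) → EuclideanSpace ℝ (Fin d)) : ℝ :=
  sInf {r | ∃ L : List (ℝ × ℝ), ValidShortcuts n L ∧
    r = frechetDist X (shortcutFrom (polyCurve w) L 0)}

/-! ### Piecewise linear interpolation of sequences -/

section Interpolation

variable {E : Type*} [NormedAddCommGroup E] [NormedSpace ℝ E]

/-- The piecewise linear function interpolating the sequence `s` at the natural numbers. -/
def interp (s : ℕ → E) (u : ℝ) : E :=
  (1 - (u - ⌊u⌋₊)) • s ⌊u⌋₊ + (u - ⌊u⌋₊) • s (⌊u⌋₊ + 1)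

lemma interp_natCast (s : ℕ → E) (k : ℕ) : interp s k = s k := by
  simp [interp]

lemma interp_eq_of_floor_eq (s : ℕ → E) {k : ℕ} {u : ℝ} (h : ⌊u⌋₊ = k) :
    interp s u = (1 - (u - k)) • s k + (u - k) • s (k + 1) := by
  rw [interp, h]

lemma interp_of_mem_Icc (s : ℕ → E) {k : ℕ} {u : ℝ} (hu : u ∈ Icc (k : ℝ) (k + 1)) :
    interp s u = (1 - (u - k)) • s k + (u - k) • s (k + 1) := by
  rcases hu.2.lt_or_eq with h | h
  · exact interp_eq_of_floor_eq s
      ((Nat.floor_eq_iff ((Nat.cast_nonneg k).trans hu.1)).2 ⟨hu.1, h⟩)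
  · have : u = ((k + 1 : ℕ) : ℝ) := by push_cast; exact h
    rw [this, interp_natCast]
    simp

lemma interp_of_le_one (s : ℕ → E) {u : ℝ} (hu : u ≤ 1) :
    interp s u = (1 - u) • s 0 + u • s 1 := by
  rcases le_total 0 u with h | h
  · simpa using interp_of_mem_Icc s (k := 0) (u := u) (by simpa using ⟨h, hu⟩)
  · simpa using interp_eq_of_floor_eq s (Nat.floor_of_nonpos h)

lemma continuousOn_interp (s : ℕ → E) (N : ℕ) : ContinuousOn (interp s) (Iic ((N : ℝ) + 1)) := by
  induction N with
  | zero =>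
    have : ContinuousOn (fun u : ℝ => (1 - u) • s 0 + u • s 1) (Iic (((0 : ℕ) : ℝ) + 1)) := by
      fun_prop
    exact this.congr fun u hu => interp_of_le_one s (by simpa using hu)
  | succ N ih =>
    have h2 : ContinuousOn (interp s) (Icc (((N + 1 : ℕ) : ℝ)) ((N + 1 : ℕ) + 1)) := by
      have : ContinuousOn (fun u : ℝ => (1 - (u - (N + 1 : ℕ))) • s (N + 1)
          + (u - (N + 1 : ℕ)) • s (N + 1 + 1)) (Icc (((N + 1 : ℕ) : ℝ)) ((N + 1 : ℕ) + 1)) := by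
        fun_prop
      exact this.congr fun u hu => interp_of_mem_Icc s hu
    have := ih.union_of_isClosed h2 isClosed_Iic isClosed_Icc
    refine this.mono fun u hu => ?_
    rcases le_total u (N + 1) with h | h
    · exact Or.inl h
    · exact Or.inr ⟨by push_cast; exact h, hu⟩

lemma continuous_interp (s : ℕ → E) : Continuous (interp s) := by
  refine continuous_iff_continuousAt.2 fun u => ?_
  obtain ⟨N, hN⟩ := exists_nat_gt u
  exact (continuousOn_interp s N).continuousAt (Iic_mem_nhds (by linarith))

lemma monotoneOn_interp {s : ℕ → ℝ} (hs : Monotone s) (N : ℕ) :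
    MonotoneOn (interp s) (Iic ((N : ℝ) + 1)) := by
  induction N with
  | zero =>
    intro u hu w hw huw
    rw [interp_of_le_one s (by simpa using hu), interp_of_le_one s (by simpa using hw)]
    have := hs (Nat.zero_le 1)
    simp only [smul_eq_mul]
    nlinarith
  | succ N ih =>
    have h2 : MonotoneOn (interp s) (Icc (((N + 1 : ℕ) : ℝ)) ((N + 1 : ℕ) + 1)) := by
      intro u hu w hw huw
      rw [interp_of_mem_Icc s hu, interp_of_mem_Icc s hw]
      have := hs (Nat.le_succ (N + 1))
      simp only [smul_eq_mul, Nat.succ_eq_add_one] at this ⊢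
      nlinarith
    have hc : ((N + 1 : ℕ) : ℝ) = N + 1 := by push_cast; rfl
    rw [hc] at h2
    have := ih.union_right h2 (c := (N : ℝ) + 1) isGreatest_Iic
      (isLeast_Icc (by linarith))
    refine this.mono fun u hu => ?_
    rcases le_total u (N + 1) with h | h
    · exact Or.inl h
    · exact Or.inr ⟨h, by rw [← hc]; exact hu⟩

lemma monotone_interp {s : ℕ → ℝ} (hs : Monotone s) : Monotone (interp s) := by
  intro u w huw
  obtain ⟨N, hN⟩ := exists_nat_gt w
  exact monotoneOn_interp hs N (show u ≤ (N : ℝ) + 1 by linarith)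
    (show w ≤ (N : ℝ) + 1 by linarith) huw

/-- Interpolating along a sequence of indices with increments `0` or `1` is the same as
interpolating the subsequence. -/
lemma interp_interp (s : ℕ → E) {a : ℕ → ℕ} (ha : ∀ i, a (i + 1) = a i ∨ a (i + 1) = a i + 1)
    {u : ℝ} (hu : 0 ≤ u) :
    interp s (interp (fun i => (a i : ℝ)) u) = interp (fun i => s (a i)) u := by
  set k := ⌊u⌋₊ with hk
  have hmem : u ∈ Icc (k : ℝ) (k + 1) := ⟨Nat.floor_le hu, (Nat.lt_floor_add_one u).le⟩
  rw [interp_of_mem_Icc _ hmem, interp_of_mem_Icc _ hmem]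
  rcases ha k with h | h
  · have : (1 - (u - k)) • (a k : ℝ) + (u - k) • ((a (k + 1) : ℕ) : ℝ) = (a k : ℕ) := by
      rw [h]; simp only [smul_eq_mul]; ring
    rw [this, interp_natCast, h, ← add_smul]
    simp
  · have : (1 - (u - k)) • (a k : ℝ) + (u - k) • ((a (k + 1) : ℕ) : ℝ) = a k + (u - k) := by
      rw [h]; simp only [smul_eq_mul]; push_cast; ring
    rw [this, interp_of_mem_Icc s (k := a k)
      ⟨by linarith [hmem.1], by linarith [hmem.2]⟩, h]
    simp

lemma norm_interp_sub_interp_le {s s' : ℕ → E} {r : ℝ} (h : ∀ i, ‖s i - s' i‖ ≤ r)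
    {u : ℝ} (hu : 0 ≤ u) : ‖interp s u - interp s' u‖ ≤ r := by
  have h0 : 0 ≤ u - ⌊u⌋₊ := sub_nonneg.2 (Nat.floor_le hu)
  have h1 : 0 ≤ 1 - (u - ⌊u⌋₊) := by linarith [Nat.lt_floor_add_one u]
  have := (convex_closedBall (0 : E) r) (x := s ⌊u⌋₊ - s' ⌊u⌋₊)
    (by simpa using h _) (y := s (⌊u⌋₊ + 1) - s' (⌊u⌋₊ + 1)) (by simpa using h _) h1 h0 (by ring)
  rw [mem_closedBall_zero_iff] at this
  refine le_trans (le_of_eq ?_) this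
  congr 1
  simp only [interp, smul_sub]
  abel

end Interpolation

lemma polyCurve_eq_interp {n : ℕ} (v : Fin (n+1) → EuclideanSpace ℝ (Fin d)) (t : ℝ) :
    polyCurve v t = interp (vtx v) (t * n) := rfl

lemma continuous_polyCurve {n : ℕ} (v : Fin (n+1) → EuclideanSpace ℝ (Fin d)) :
    Continuous (polyCurve v) :=
  (continuous_interp (vtx v)).comp (continuous_id.mul continuous_const)

/-! ### Reparameterizations -/

lemma isReparam_id : IsReparam id :=
  ⟨continuousOn_id, strictMonoOn_id, mapsTo_id _, surjOn_id _, rfl, rfl⟩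

lemma IsReparam.comp {f g : ℝ → ℝ} (hf : IsReparam f) (hg : IsReparam g) : IsReparam (f ∘ g) where
  contOn := hf.contOn.comp hg.contOn hg.mapsTo
  strictMonoOn := hf.strictMonoOn.comp hg.strictMonoOn hg.mapsTo
  mapsTo := hf.mapsTo.comp hg.mapsTo
  surjOn := hf.surjOn.comp hg.surjOn
  map_zero := by simp [hg.map_zero, hf.map_zero]
  map_one := by simp [hg.map_one, hf.map_one]

lemma IsReparam.of_continuousOn {f : ℝ → ℝ} (hc : ContinuousOn f (Icc 0 1))
    (hm : StrictMonoOn f (Icc 0 1)) (h0 : f 0 = 0) (h1 : f 1 = 1) : IsReparam f where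
  contOn := hc
  strictMonoOn := hm
  mapsTo := by
    have := hm.monotoneOn.mapsTo_Icc
    rwa [h0, h1] at this
  surjOn := by
    have := intermediate_value_Icc zero_le_one hc
    rwa [h0, h1] at this
  map_zero := h0
  map_one := h1

lemma IsReparam.exists_rightInverse {f : ℝ → ℝ} (hf : IsReparam f) :
    ∃ g, IsReparam g ∧ ∀ t ∈ Icc (0 : ℝ) 1, f (g t) = t := by
  have hmono : StrictMono (hf.mapsTo.restrict f (Icc 0 1) (Icc 0 1)) := fun x y hxy =>
    hf.strictMonoOn x.2 y.2 hxy
  have hsurj : Function.Surjective (hf.mapsTo.restrict f (Icc 0 1) (Icc 0 1)) := fun y => by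
    obtain ⟨x, hx, hxy⟩ := hf.surjOn y.2
    exact ⟨⟨x, hx⟩, Subtype.ext hxy⟩
  let e := hmono.orderIsoOfSurjective _ hsurj
  have he : ∀ x : Icc (0 : ℝ) 1, f (e.symm x) = x := fun x =>
    congrArg Subtype.val (e.apply_symm_apply x)
  let g : ℝ → ℝ := IccExtend zero_le_one fun x : Icc (0 : ℝ) 1 => (e.symm x : ℝ)
  have hg : ∀ (t : ℝ) (ht : t ∈ Icc (0 : ℝ) 1), g t = e.symm ⟨t, ht⟩ := fun t ht =>
    IccExtend_of_mem _ _ ht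
  have hfg : ∀ t ∈ Icc (0 : ℝ) 1, f (g t) = t := fun t ht => by rw [hg t ht, he]
  have hmaps : ∀ t ∈ Icc (0 : ℝ) 1, g t ∈ Icc (0 : ℝ) 1 := fun t ht => by
    rw [hg t ht]; exact (e.symm _).2
  have h0 : (0 : ℝ) ∈ Icc (0 : ℝ) 1 := ⟨le_rfl, zero_le_one⟩
  have h1 : (1 : ℝ) ∈ Icc (0 : ℝ) 1 := ⟨zero_le_one, le_rfl⟩
  refine ⟨g, IsReparam.of_continuousOn ?_ ?_ ?_ ?_, hfg⟩
  · exact (Continuous.Icc_extend' (continuous_subtype_val.comp e.symm.continuous)).continuousOn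
  · intro s hs t ht hst
    rw [hg s hs, hg t ht]
    exact e.symm.strictMono hst
  · exact hf.strictMonoOn.injOn (hmaps 0 h0) h0 (by rw [hfg 0 h0, hf.map_zero])
  · exact hf.strictMonoOn.injOn (hmaps 1 h1) h1 (by rw [hfg 1 h1, hf.map_one])

lemma continuousOn_ite_half {F : Type*} [TopologicalSpace F] {A B : ℝ → F}
    (hA : ContinuousOn A (Icc 0 1)) (hB : ContinuousOn B (Icc 0 1)) (hAB : A 1 = B 0) :
    ContinuousOn (fun t : ℝ => if t ≤ 1/2 then A (2 * t) else B (2 * t - 1)) (Icc 0 1) := by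
  have h1 : ContinuousOn (fun t : ℝ => if t ≤ 1/2 then A (2 * t) else B (2 * t - 1))
      (Icc 0 (1/2)) := by
    have : ContinuousOn (fun t : ℝ => A (2 * t)) (Icc 0 (1/2)) :=
      hA.comp (by fun_prop) fun t ht => ⟨by linarith [ht.1], by linarith [ht.2]⟩
    exact this.congr fun t ht => if_pos ht.2
  have h2 : ContinuousOn (fun t : ℝ => if t ≤ 1/2 then A (2 * t) else B (2 * t - 1))
      (Icc (1/2) 1) := by
    have : ContinuousOn (fun t : ℝ => B (2 * t - 1)) (Icc (1/2) 1) :=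
      hB.comp (by fun_prop) fun t ht => ⟨by linarith [ht.1], by linarith [ht.2]⟩
    refine this.congr fun t ht => ?_
    rcases ht.1.lt_or_eq with h | h
    · exact if_neg (not_le.2 h)
    · subst h
      simp [hAB]
  have := h1.union_of_isClosed h2 isClosed_Icc isClosed_Icc
  rwa [Icc_union_Icc_eq_Icc (by norm_num) (by norm_num)] at this

lemma IsReparam.glue {f g : ℝ → ℝ} (hf : IsReparam f) (hg : IsReparam g) :
    IsReparam fun t => if t ≤ 1/2 then f (2 * t) / 2 else (1 + g (2 * t - 1)) / 2 := by
  refine IsReparam.of_continuousOn ?_ ?_ ?_ ?_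
  · exact continuousOn_ite_half (A := fun t => f t / 2) (B := fun t => (1 + g t) / 2)
      (hf.contOn.div_const 2) ((continuousOn_const.add hg.contOn).div_const 2)
      (by simp [hf.map_one, hg.map_zero])
  · intro s hs t ht hst
    simp only
    split_ifs with h1 h2 h2
    · have := hf.strictMonoOn (a := 2 * s) (b := 2 * t) ⟨by linarith [hs.1], by linarith⟩
        ⟨by linarith [ht.1], by linarith⟩ (by linarith)
      linarith
    · have a1 := (hf.mapsTo (x := 2 * s) ⟨by linarith [hs.1], by linarith⟩).2
      have a2 := hg.strictMonoOn (a := 0) (b := 2 * t - 1) ⟨le_rfl, zero_le_one⟩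
        ⟨by linarith, by linarith [ht.2]⟩ (by linarith)
      rw [hg.map_zero] at a2
      linarith
    · linarith
    · have := hg.strictMonoOn (a := 2 * s - 1) (b := 2 * t - 1) ⟨by linarith, by linarith [hs.2]⟩
        ⟨by linarith, by linarith [ht.2]⟩ (by linarith)
      linarith
  · simp [hf.map_zero]
  · norm_num [hg.map_one]

/-- A reparameterization that is allowed to be constant on subintervals. -/
structure IsWeakReparam (f : ℝ → ℝ) : Prop where
  contOn : ContinuousOn f (Icc 0 1)
  monotoneOn : MonotoneOn f (Icc 0 1)
  map_zero : f 0 = 0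
  map_one : f 1 = 1

lemma isWeakReparam_id : IsWeakReparam id :=
  ⟨continuousOn_id, monotoneOn_id, rfl, rfl⟩

lemma IsWeakReparam.mapsTo {f : ℝ → ℝ} (hf : IsWeakReparam f) :
    MapsTo f (Icc 0 1) (Icc 0 1) := by
  have := hf.monotoneOn.mapsTo_Icc
  rwa [hf.map_zero, hf.map_one] at this

/-- A weak reparameterization is a uniform limit of reparameterizations. -/
lemma IsWeakReparam.exists_isReparam_near {f : ℝ → ℝ} (hf : IsWeakReparam f) {δ : ℝ}
    (hδ : 0 < δ) : ∃ g, IsReparam g ∧ ∀ t ∈ Icc (0 : ℝ) 1, |g t - f t| < δ := by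
  set η := min (δ / 2) 1 with hη
  have hη0 : 0 < η := lt_min (by linarith) one_pos
  have hη1 : η ≤ 1 := min_le_right _ _
  have hηδ : η < δ := (min_le_left _ _).trans_lt (by linarith)
  refine ⟨fun t => (1 - η) * f t + η * t, IsReparam.of_continuousOn ?_ ?_ ?_ ?_, ?_⟩
  · exact (continuousOn_const.mul hf.contOn).add (continuousOn_const.mul continuousOn_id)
  · intro s hs t ht hst
    have := mul_le_mul_of_nonneg_left (hf.monotoneOn hs ht hst.le) (sub_nonneg.2 hη1)
    have := mul_lt_mul_of_pos_left hst hη0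
    simp only
    linarith
  · simp [hf.map_zero]
  · simp [hf.map_one]
  · intro t ht
    have hft := hf.mapsTo ht
    have : (1 - η) * f t + η * t - f t = η * (t - f t) := by ring
    rw [this, abs_mul, abs_of_pos hη0]
    have h2 : |t - f t| ≤ 1 := abs_le.2 ⟨by linarith [ht.1, hft.2], by linarith [ht.2, hft.1]⟩
    nlinarith

/-- The restriction of a monotone continuous function to `[s,t]`, normalized. -/
lemma exists_isWeakReparam_affine {α : ℝ → ℝ} (hc : Continuous α) (hm : Monotone α) {s t : ℝ}
    (hst : s ≤ t) : ∃ f, IsWeakReparam f ∧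
      ∀ τ ∈ Icc (0 : ℝ) 1, α s + f τ * (α t - α s) = α (s + τ * (t - s)) := by
  rcases (hm hst).lt_or_eq with h | h
  · have h' : α t - α s ≠ 0 := (sub_pos.2 h).ne'
    refine ⟨fun τ => (α (s + τ * (t - s)) - α s) / (α t - α s), ⟨?_, ?_, ?_, ?_⟩, ?_⟩
    · exact Continuous.continuousOn (by fun_prop)
    · intro u _ w _ huw
      have : α (s + u * (t - s)) ≤ α (s + w * (t - s)) :=
        hm (by linarith [mul_le_mul_of_nonneg_right huw (sub_nonneg.2 hst)])
      exact div_le_div_of_nonneg_right (by linarith) (sub_pos.2 h).le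
    · simp
    · simp [div_self h']
    · intro τ _
      rw [div_mul_cancel₀ _ h']
      ring
  · refine ⟨id, isWeakReparam_id, fun τ hτ => ?_⟩
    rw [← h, sub_self, mul_zero, add_zero]
    have h0 := mul_nonneg hτ.1 (sub_nonneg.2 hst)
    have h1 := mul_le_mul_of_nonneg_right hτ.2 (sub_nonneg.2 hst)
    refine le_antisymm (hm (by linarith)) ?_
    rw [h]
    exact hm (by linarith)

/-! ### Curves at Fréchet distance at most `r` -/

/-- `A` and `B` can be matched by reparameterizations of width arbitrarily close to `r`. -/
def FrechetClose (r : ℝ) (A B : ℝ → EuclideanSpace ℝ (Fin d)) : Prop :=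
  ∀ ε > 0, ∃ f, IsReparam f ∧ ∀ t ∈ Icc (0 : ℝ) 1, ‖A (f t) - B t‖ ≤ r + ε

variable {A A' B B' C : ℝ → EuclideanSpace ℝ (Fin d)} {r r' : ℝ}

lemma FrechetClose.of_norm_sub_le (h : ∀ t ∈ Icc (0 : ℝ) 1, ‖A t - B t‖ ≤ r) :
    FrechetClose r A B :=
  fun ε hε => ⟨id, isReparam_id, fun t ht => (h t ht).trans (by linarith)⟩

lemma FrechetClose.trans (hAB : FrechetClose r A B) (hBC : FrechetClose r' B C) :
    FrechetClose (r + r') A C := by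
  intro ε hε
  obtain ⟨f, hf, hf'⟩ := hAB (ε / 2) (by linarith)
  obtain ⟨g, hg, hg'⟩ := hBC (ε / 2) (by linarith)
  refine ⟨f ∘ g, hf.comp hg, fun t ht => ?_⟩
  have h1 := hf' (g t) (hg.mapsTo ht)
  have h2 := hg' t ht
  have h3 := norm_sub_le_norm_sub_add_norm_sub (A (f (g t))) (B (g t)) (C t)
  simp only [Function.comp]
  linarith

lemma FrechetClose.concat (hA : FrechetClose r A A') (hB : FrechetClose r B B') :
    FrechetClose r (concat A B) (concat A' B') := by
  intro ε hε
  obtain ⟨f, hf, hf'⟩ := hA ε hε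
  obtain ⟨g, hg, hg'⟩ := hB ε hε
  refine ⟨_, hf.glue hg, fun t ht => ?_⟩
  by_cases h : t ≤ 1/2
  · have hmem : 2 * t ∈ Icc (0 : ℝ) 1 := ⟨by linarith [ht.1], by linarith⟩
    have h1 := (hf.mapsTo hmem).2
    simp only [Jaywalk.concat, if_pos h]
    rw [if_pos (by linarith), mul_div_cancel₀ _ two_ne_zero]
    exact hf' _ hmem
  · have hmem : 2 * t - 1 ∈ Icc (0 : ℝ) 1 := ⟨by linarith, by linarith [ht.2]⟩
    have h1 := hg.strictMonoOn ⟨le_rfl, zero_le_one⟩ hmem (by linarith)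
    rw [hg.map_zero] at h1
    simp only [Jaywalk.concat, if_neg h]
    rw [if_neg (by linarith), mul_div_cancel₀ _ two_ne_zero, add_sub_cancel_left]
    exact hg' _ hmem

lemma FrechetClose.seg {p q p' q' : EuclideanSpace ℝ (Fin d)} (hp : ‖p - p'‖ ≤ r)
    (hq : ‖q - q'‖ ≤ r) : FrechetClose r (seg p q) (seg p' q') := by
  refine FrechetClose.of_norm_sub_le fun t ht => ?_
  have := (convex_closedBall (0 : EuclideanSpace ℝ (Fin d)) r) (x := p - p') (by simpa using hp)
    (y := q - q') (by simpa using hq) (sub_nonneg.2 ht.2) ht.1 (by ring)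
  rw [mem_closedBall_zero_iff] at this
  refine le_trans (le_of_eq ?_) this
  congr 1
  simp only [Jaywalk.seg, smul_sub]
  abel

lemma FrechetClose.of_isWeakReparam (hA : ContinuousOn A (Icc 0 1)) (hB : ContinuousOn B (Icc 0 1))
    {α β : ℝ → ℝ} (hα : IsWeakReparam α) (hβ : IsWeakReparam β)
    (h : ∀ t ∈ Icc (0 : ℝ) 1, ‖A (α t) - B (β t)‖ ≤ r) : FrechetClose r A B := by
  intro ε hε
  have hε2 : 0 < ε / 2 := by linarith
  obtain ⟨δ, hδ, hAδ⟩ := Metric.uniformContinuousOn_iff.1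
    (isCompact_Icc.uniformContinuousOn_of_continuous hA) _ hε2
  obtain ⟨δ', hδ', hBδ⟩ := Metric.uniformContinuousOn_iff.1
    (isCompact_Icc.uniformContinuousOn_of_continuous hB) _ hε2
  obtain ⟨f, hf, hfα⟩ := hα.exists_isReparam_near hδ
  obtain ⟨g, hg, hgβ⟩ := hβ.exists_isReparam_near hδ'
  obtain ⟨k, hk, hgk⟩ := hg.exists_rightInverse
  refine ⟨f ∘ k, hf.comp hk, fun t ht => ?_⟩
  have hs := hk.mapsTo ht
  have h1 := hAδ _ (hf.mapsTo hs) _ (hα.mapsTo hs) (hfα _ hs)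
  have h2 := hBδ _ (hβ.mapsTo hs) _ (hg.mapsTo hs) (by rw [dist_comm]; exact hgβ _ hs)
  have h3 := h _ hs
  rw [hgk t ht] at h2
  rw [dist_eq_norm] at h1 h2
  have h4 := norm_sub_le_norm_sub_add_norm_sub (A (f (k t))) (A (α (k t))) (B t)
  have h5 := norm_sub_le_norm_sub_add_norm_sub (A (α (k t))) (B (β (k t))) (B t)
  simp only [Function.comp]
  linarith

lemma FrechetClose.subcurve (hA : Continuous A) (hB : Continuous B) {α β : ℝ → ℝ}
    (hαc : Continuous α) (hαm : Monotone α) (hβc : Continuous β) (hβm : Monotone β) {s t : ℝ}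
    (hst : s ≤ t) (h : ∀ u ∈ Icc s t, ‖A (α u) - B (β u)‖ ≤ r) :
    FrechetClose r (subcurve A (α s) (α t)) (subcurve B (β s) (β t)) := by
  obtain ⟨f, hf, hfα⟩ := exists_isWeakReparam_affine hαc hαm hst
  obtain ⟨g, hg, hgβ⟩ := exists_isWeakReparam_affine hβc hβm hst
  refine FrechetClose.of_isWeakReparam (Continuous.continuousOn ?_) (Continuous.continuousOn ?_)
    hf hg fun τ hτ => ?_
  · exact hA.comp (by fun_prop)
  · exact hB.comp (by fun_prop)
  · simp only [Jaywalk.subcurve]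
    rw [hfα τ hτ, hgβ τ hτ]
    have h0 := mul_nonneg hτ.1 (sub_nonneg.2 hst)
    have h1 := mul_le_mul_of_nonneg_right hτ.2 (sub_nonneg.2 hst)
    exact h _ ⟨by linarith, by linarith⟩

lemma frechetWidth_nonneg (A B : ℝ → EuclideanSpace ℝ (Fin d)) (f : ℝ → ℝ) :
    0 ≤ frechetWidth A B f :=
  Real.iSup_nonneg fun _ => norm_nonneg _

lemma frechetDist_nonneg (A B : ℝ → EuclideanSpace ℝ (Fin d)) : 0 ≤ frechetDist A B := by
  refine Real.sInf_nonneg ?_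
  rintro _ ⟨f, _, rfl⟩
  exact frechetWidth_nonneg A B f

lemma FrechetClose.frechetDist_le (h : FrechetClose r A B) : frechetDist A B ≤ r := by
  refine le_of_forall_pos_le_add fun ε hε => ?_
  obtain ⟨f, hf, hfr⟩ := h ε hε
  have hbdd : BddBelow {w | ∃ f, IsReparam f ∧ w = frechetWidth A B f} := by
    refine ⟨0, ?_⟩
    rintro _ ⟨f, _, rfl⟩
    exact frechetWidth_nonneg A B f
  refine (csInf_le hbdd ⟨f, hf, rfl⟩).trans ?_
  have : Nonempty (Icc (0 : ℝ) 1) := ⟨⟨0, le_rfl, zero_le_one⟩⟩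
  exact ciSup_le fun t => hfr t t.2

lemma frechetClose_frechetDist (hA : ContinuousOn A (Icc 0 1)) (hB : ContinuousOn B (Icc 0 1)) :
    FrechetClose (frechetDist A B) A B := by
  intro ε hε
  obtain ⟨_, ⟨f, hf, rfl⟩, hlt⟩ := exists_lt_of_csInf_lt
    (s := {w | ∃ f, IsReparam f ∧ w = frechetWidth A B f}) ⟨_, id, isReparam_id, rfl⟩
    (show sInf _ < frechetDist A B + ε from lt_add_of_pos_right (frechetDist A B) hε)
  refine ⟨f, hf, fun t ht => le_trans ?_ hlt.le⟩
  have hc : ContinuousOn (fun t => ‖A (f t) - B t‖) (Icc 0 1) :=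
    ((hA.comp hf.contOn hf.mapsTo).sub hB).norm
  have hbdd := isCompact_Icc.bddAbove_image hc
  rw [image_eq_range] at hbdd
  exact le_ciSup hbdd ⟨t, ht⟩

/-! ### Shortcut curves -/

lemma shortcutFrom_zero (Y : ℝ → EuclideanSpace ℝ (Fin d)) (L : List (ℝ × ℝ)) (a : ℝ) :
    shortcutFrom Y L a 0 = Y a := by
  cases L <;> simp [shortcutFrom, concat, subcurve]

lemma continuousOn_concat (hA : ContinuousOn A (Icc 0 1)) (hB : ContinuousOn B (Icc 0 1))
    (hAB : A 1 = B 0) : ContinuousOn (concat A B) (Icc 0 1) :=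
  continuousOn_ite_half hA hB hAB

lemma continuousOn_shortcutFrom {Y : ℝ → EuclideanSpace ℝ (Fin d)} (hY : Continuous Y)
    (L : List (ℝ × ℝ)) (a : ℝ) : ContinuousOn (shortcutFrom Y L a) (Icc 0 1) := by
  have hsub : ∀ s t, ContinuousOn (subcurve Y s t) (Icc 0 1) := fun s t =>
    (hY.comp (by fun_prop : Continuous fun τ : ℝ => s + τ * (t - s))).continuousOn
  induction L generalizing a with
  | nil => exact hsub a 1
  | cons p L ih =>
    refine continuousOn_concat (hsub _ _) (continuousOn_concat ?_ (ih _) ?_) ?_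
    · exact Continuous.continuousOn (by unfold seg; fun_prop)
    · rw [shortcutFrom_zero]
      simp [seg]
    · simp [concat, subcurve, seg]

lemma subcurve_zero_one (Y : ℝ → EuclideanSpace ℝ (Fin d)) : subcurve Y 0 1 = Y := by
  funext t
  simp [subcurve]

lemma validShortcuts_nil (n : ℕ) : ValidShortcuts n [] := by
  refine ⟨List.isChain_pair.2 zero_le_one, by simp⟩

/-- A lattice path from `0` to `n` in `N` steps, each of size `0` or `1`. -/
structure IsLatticePath (n N : ℕ) (a : ℕ → ℕ) : Prop where
  zero : a 0 = 0
  step : ∀ i, a (i + 1) = a i ∨ a (i + 1) = a i + 1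
  last : a N = n

namespace IsLatticePath

variable {n N : ℕ} {a : ℕ → ℕ}

lemma monotone (ha : IsLatticePath n N a) : Monotone a :=
  monotone_nat_of_le_succ fun i => by rcases ha.step i with h | h <;> omega

lemma exists_eq (ha : IsLatticePath n N a) {i j : ℕ} (hi : i ≤ N) (hij : a i ≤ j) (hj : j ≤ n) :
    ∃ k, i ≤ k ∧ k ≤ N ∧ a k = j := by
  have key : ∀ m, i ≤ m → j ≤ a m → ∃ k, i ≤ k ∧ k ≤ m ∧ a k = j := by
    intro m hm
    induction m, hm using Nat.le_induction with
    | base => exact fun h => ⟨i, le_rfl, le_rfl, le_antisymm hij h⟩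
    | succ m hm ih =>
      intro h
      by_cases h' : j ≤ a m
      · obtain ⟨k, h1, h2, h3⟩ := ih h'
        exact ⟨k, h1, h2.trans (Nat.le_succ m), h3⟩
      · refine ⟨m + 1, by omega, le_rfl, ?_⟩
        rcases ha.step m with h'' | h'' <;> omega
  exact key N hi (by rw [ha.last]; exact hj)

/-- The parameter, in a polygonal curve with `n` edges, of the point at time `u` of the path. -/
def param (n : ℕ) (a : ℕ → ℕ) (u : ℝ) : ℝ := interp (fun i => (a i : ℝ)) u / n

lemma param_natCast (n : ℕ) (a : ℕ → ℕ) (i : ℕ) : param n a i = (a i : ℝ) / n := by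
  rw [param, interp_natCast]

lemma continuous_param (n : ℕ) (a : ℕ → ℕ) : Continuous (param n a) :=
  (continuous_interp _).div_const _

lemma monotone_param (ha : IsLatticePath n N a) : Monotone (param n a) := fun _ _ h =>
  div_le_div_of_nonneg_right
    (monotone_interp (fun _ _ hij => Nat.cast_le.2 (ha.monotone hij)) h) (Nat.cast_nonneg n)

lemma polyCurve_param (ha : IsLatticePath n N a) (hn : 0 < n)
    (v : Fin (n+1) → EuclideanSpace ℝ (Fin d)) {u : ℝ} (hu : 0 ≤ u) :
    polyCurve v (param n a u) = interp (fun i => vtx v (a i)) u := by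
  have : (n : ℝ) ≠ 0 := Nat.cast_ne_zero.2 hn.ne'
  rw [polyCurve_eq_interp, param, div_mul_cancel₀ _ this, interp_interp _ ha.step hu]

end IsLatticePath

section Coupling

variable {n N : ℕ} {a b : ℕ → ℕ} {v w : Fin (n+1) → EuclideanSpace ℝ (Fin d)}

lemma norm_polyCurve_param_sub_le (hn : 0 < n) (ha : IsLatticePath n N a)
    (hb : IsLatticePath n N b) (h : ∀ i, ‖vtx v (a i) - vtx w (b i)‖ ≤ r) {u : ℝ} (hu : 0 ≤ u) :
    ‖polyCurve v (IsLatticePath.param n a u) - polyCurve w (IsLatticePath.param n b u)‖ ≤ r := by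
  rw [ha.polyCurve_param hn v hu, hb.polyCurve_param hn w hu]
  exact norm_interp_sub_interp_le h hu

lemma frechetClose_subcurve_polyCurve (hn : 0 < n) (ha : IsLatticePath n N a)
    (hb : IsLatticePath n N b) (h : ∀ i, ‖vtx v (a i) - vtx w (b i)‖ ≤ r) {i j : ℕ} (hij : i ≤ j) :
    FrechetClose r (subcurve (polyCurve v) ((a i : ℝ) / n) ((a j : ℝ) / n))
      (subcurve (polyCurve w) ((b i : ℝ) / n) ((b j : ℝ) / n)) := by
  simp only [← IsLatticePath.param_natCast]
  refine FrechetClose.subcurve (continuous_polyCurve v) (continuous_polyCurve w)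
    (IsLatticePath.continuous_param n a) ha.monotone_param (IsLatticePath.continuous_param n b)
    hb.monotone_param (Nat.cast_le.2 hij) fun u hu => ?_
  exact norm_polyCurve_param_sub_le hn ha hb h ((Nat.cast_nonneg i).trans hu.1)

/-- Shortcuts can be transferred along a coupling of the vertices of two polygonal curves. -/
lemma exists_frechetClose_shortcutFrom (hn : 0 < n) (ha : IsLatticePath n N a)
    (hb : IsLatticePath n N b) (h : ∀ i, ‖vtx v (a i) - vtx w (b i)‖ ≤ r)
    (L : List (ℝ × ℝ)) {i : ℕ} (hi : i ≤ N)
    (hchain : List.IsChain (· ≤ ·)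
      (((a i : ℝ) / n) :: (L.flatMap fun p => [p.1, p.2]) ++ [1]))
    (hL : ∀ p ∈ L, vertexParam n p.1 ∧ vertexParam n p.2) :
    ∃ L' : List (ℝ × ℝ), L'.length = L.length ∧
      List.IsChain (· ≤ ·) (((b i : ℝ) / n) :: (L'.flatMap fun p => [p.1, p.2]) ++ [1]) ∧
      (∀ p ∈ L', vertexParam n p.1 ∧ vertexParam n p.2) ∧
      FrechetClose r (shortcutFrom (polyCurve v) L ((a i : ℝ) / n))
        (shortcutFrom (polyCurve w) L' ((b i : ℝ) / n)) := by
  have hn' : (0 : ℝ) < n := Nat.cast_pos.2 hn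
  have hbn : ∀ k ≤ N, b k ≤ n := fun k hk => (hb.monotone hk).trans hb.last.le
  have hpt : ∀ k : ℕ, ‖polyCurve v ((a k : ℝ) / n) - polyCurve w ((b k : ℝ) / n)‖ ≤ r := by
    intro k
    simpa only [IsLatticePath.param_natCast] using
      norm_polyCurve_param_sub_le hn ha hb h (Nat.cast_nonneg k)
  have hmono : ∀ {k l}, k ≤ l → (b k : ℝ) / n ≤ (b l : ℝ) / n := fun hkl =>
    div_le_div_of_nonneg_right (Nat.cast_le.2 (hb.monotone hkl)) hn'.le
  induction L generalizing i with
  | nil =>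
    refine ⟨[], rfl, ?_, by simp, ?_⟩
    · have := hmono hi
      rw [hb.last, div_self hn'.ne'] at this
      simpa using this
    · have := frechetClose_subcurve_polyCurve hn ha hb h hi
      rwa [ha.last, hb.last, div_self hn'.ne'] at this
  | cons p L ih =>
    obtain ⟨⟨⟨j, hj⟩, hp1⟩, ⟨⟨l, hl⟩, hp2⟩⟩ := hL p List.mem_cons_self
    simp only [List.flatMap_cons, List.cons_append, List.nil_append,
      List.isChain_cons_cons] at hchain
    obtain ⟨h1, h2, h3⟩ := hchain
    rw [hp1, div_le_div_iff_of_pos_right hn', Nat.cast_le] at h1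
    obtain ⟨i₁, hi₁, hi₁N, rfl⟩ := ha.exists_eq hi h1 (Nat.lt_succ_iff.1 hj)
    simp only at hp1
    rw [hp1, hp2, div_le_div_iff_of_pos_right hn', Nat.cast_le] at h2
    obtain ⟨i₂, hi₂, hi₂N, rfl⟩ := ha.exists_eq hi₁N h2 (Nat.lt_succ_iff.1 hl)
    simp only at hp2
    rw [hp2] at h3
    obtain ⟨L', hlen, hchain', hL', hclose⟩ :=
      ih hi₂N h3 fun q hq => hL q (List.mem_cons_of_mem p hq)
    refine ⟨((b i₁ : ℝ) / n, (b i₂ : ℝ) / n) :: L', by simp [hlen], ?_, ?_, ?_⟩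
    · simp only [List.flatMap_cons, List.cons_append, List.nil_append, List.isChain_cons_cons]
      exact ⟨hmono hi₁, hmono hi₂, hchain'⟩
    · rintro q (_ | ⟨_, hq⟩)
      · exact ⟨⟨⟨b i₁, Nat.lt_succ_iff.2 (hbn _ hi₁N)⟩, rfl⟩,
          ⟨⟨b i₂, Nat.lt_succ_iff.2 (hbn _ hi₂N)⟩, rfl⟩⟩
      · exact hL' q hq
    · obtain ⟨p₁, p₂⟩ := p
      simp only at hp1 hp2
      subst hp1 hp2
      exact (frechetClose_subcurve_polyCurve hn ha hb h hi₁).concat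
        ((FrechetClose.seg (hpt _) (hpt _)).concat hclose)

end Coupling

/-! ### The greedy simplification -/

section Simplification

variable (v : ℕ → EuclideanSpace ℝ (Fin d)) (μ : ℝ) (n : ℕ)

lemma simplIdx_le (k : ℕ) : simplIdx v μ n k ≤ n := by
  classical
  cases k with
  | zero => exact Nat.zero_le n
  | succ k =>
    rw [simplIdx]
    split_ifs with h
    · exact (Nat.find_spec h).2.1
    · exact le_rfl

variable {v μ n}

lemma simplIdx_lt_succ {k : ℕ} (hk : simplIdx v μ n k < n) :
    simplIdx v μ n k < simplIdx v μ n (k + 1) := by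
  classical
  conv_rhs => rw [simplIdx]
  split_ifs with h
  · exact (Nat.find_spec h).1
  · exact hk

lemma simplIdx_succ_eq_of_eq {k : ℕ} (hk : simplIdx v μ n k = n) :
    simplIdx v μ n (k + 1) = n := by
  rw [simplIdx, dif_neg]
  rintro ⟨j, h1, h2, _⟩
  omega

lemma norm_sub_simplIdx_le (hμ : 0 < μ) {i k : ℕ} (h1 : simplIdx v μ n k ≤ i)
    (h2 : i < simplIdx v μ n (k + 1)) : ‖v i - v (simplIdx v μ n k)‖ ≤ μ := by
  classical
  rcases h1.eq_or_lt with h | h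
  · simp [h, hμ.le]
  · by_contra! hlt
    have hin : i ≤ n := h2.le.trans (simplIdx_le v μ n _)
    have hex : ∃ j, simplIdx v μ n k < j ∧ j ≤ n ∧ μ ≤ ‖v j - v (simplIdx v μ n k)‖ :=
      ⟨i, h, hin, hlt.le⟩
    rw [simplIdx, dif_pos hex] at h2
    exact Nat.find_min hex h2 ⟨h, hin, hlt.le⟩

variable (v μ n)

open Classical in
/-- The position, in the simplification, of the last marked vertex up to index `i`; for
`i ≥ n` it advances through the repetitions of the final vertex. -/
def simplPos : ℕ → ℕ
  | 0 => 0
  | i+1 =>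
    if simplIdx v μ n (simplPos i + 1) ≤ i + 1 ∧ simplPos i < n then simplPos i + 1
    else simplPos i

lemma simplPos_step (i : ℕ) :
    simplPos v μ n (i + 1) = simplPos v μ n i ∨ simplPos v μ n (i + 1) = simplPos v μ n i + 1 := by
  rw [simplPos]
  split_ifs <;> simp

lemma simplPos_le (i : ℕ) : simplPos v μ n i ≤ n := by
  induction i with
  | zero => exact Nat.zero_le n
  | succ i ih =>
    rw [simplPos]
    split_ifs <;> omega

lemma simplPos_le_self (i : ℕ) : simplPos v μ n i ≤ i := by
  induction i with
  | zero => exact le_rfl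
  | succ i ih => rcases simplPos_step v μ n i with h | h <;> omega

lemma simplIdx_simplPos (i : ℕ) :
    (i < n ∧ simplIdx v μ n (simplPos v μ n i) ≤ i ∧
      i < simplIdx v μ n (simplPos v μ n i + 1)) ∨
    (n ≤ i ∧ simplIdx v μ n (simplPos v μ n i) = n) := by
  induction i with
  | zero =>
    rcases Nat.eq_zero_or_pos n with rfl | hn
    · exact Or.inr ⟨le_rfl, rfl⟩
    · have h0 : simplIdx v μ n 0 = 0 := rfl
      refine Or.inl ⟨hn, le_rfl, ?_⟩
      simpa [h0, simplPos] using simplIdx_lt_succ (v := v) (μ := μ) (k := 0) (n := n) (by rwa [h0])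
  | succ i ih =>
    have hle := simplIdx_le v μ n (simplPos v μ n i + 1)
    have hself := simplPos_le_self v μ n i
    rw [simplPos]
    rcases ih with ⟨h1, h2, h3⟩ | ⟨h1, h2⟩
    · split_ifs with h
      · have heq : simplIdx v μ n (simplPos v μ n i + 1) = i + 1 := by omega
        rcases Nat.lt_or_ge (i + 1) n with hi | hi
        · refine Or.inl ⟨hi, heq.le, ?_⟩
          have := simplIdx_lt_succ (v := v) (μ := μ) (n := n) (k := simplPos v μ n i + 1) (by omega)
          omega
        · exact Or.inr ⟨hi, by omega⟩
      · exact Or.inl ⟨by omega, by omega, by omega⟩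
    · split_ifs with h
      · exact Or.inr ⟨by omega, simplIdx_succ_eq_of_eq h2⟩
      · exact Or.inr ⟨by omega, h2⟩

lemma le_simplPos_add (i : ℕ) : i ≤ simplPos v μ n i + n ∨ simplPos v μ n i = n := by
  induction i with
  | zero => exact Or.inl (Nat.zero_le _)
  | succ i ih =>
    have hle := simplIdx_le v μ n (simplPos v μ n i + 1)
    have hpos := simplPos_le v μ n i
    rw [simplPos]
    split_ifs with h <;> omega

lemma isLatticePath_simplPos : IsLatticePath n (2 * n) (simplPos v μ n) where
  zero := rfl
  step := simplPos_step v μ n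
  last := by
    have := simplPos_le v μ n (2 * n)
    have := le_simplPos_add v μ n (2 * n)
    omega

lemma isLatticePath_min : IsLatticePath n (2 * n) fun i => min i n where
  zero := Nat.zero_min n
  step i := by omega
  last := by omega

end Simplification

lemma norm_vtx_sub_vtx_simplVerts_le {n : ℕ} (v : Fin (n+1) → EuclideanSpace ℝ (Fin d)) {μ : ℝ}
    (hμ : 0 < μ) (i : ℕ) :
    ‖vtx v (min i n) - vtx (simplVerts v μ) (simplPos (vtx v) μ n i)‖ ≤ μ := by
  have hv : vtx (simplVerts v μ) (simplPos (vtx v) μ n i) =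
      vtx v (simplIdx (vtx v) μ n (simplPos (vtx v) μ n i)) := by
    simp only [vtx, simplVerts, min_eq_left (simplPos_le _ μ n i)]
  rw [hv]
  rcases simplIdx_simplPos (vtx v) μ n i with ⟨h1, h2, h3⟩ | ⟨h1, h2⟩
  · rw [min_eq_left h1.le]
    exact norm_sub_simplIdx_le hμ h2 h3
  · rw [min_eq_right h1, h2, sub_self, norm_zero]
    exact hμ.le

/-- Every shortcut curve of the polygonal curve `v` is approximated, up to Fréchet distance `r`,
by a shortcut curve of the polygonal curve `w` with the same number of shortcuts. -/
def ShortcutClose (r : ℝ) {n : ℕ} (v w : Fin (n+1) → EuclideanSpace ℝ (Fin d)) : Prop :=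
  ∀ L, ValidShortcuts n L → ∃ L', L'.length = L.length ∧ ValidShortcuts n L' ∧
    FrechetClose r (shortcutFrom (polyCurve v) L 0) (shortcutFrom (polyCurve w) L' 0)

lemma ShortcutClose.of_isLatticePath {n N : ℕ} (hn : 0 < n) {a b : ℕ → ℕ}
    {v w : Fin (n+1) → EuclideanSpace ℝ (Fin d)} (ha : IsLatticePath n N a)
    (hb : IsLatticePath n N b) (h : ∀ i, ‖vtx v (a i) - vtx w (b i)‖ ≤ r) :
    ShortcutClose r v w := by
  rintro L ⟨hchain, hL⟩
  have := exists_frechetClose_shortcutFrom hn ha hb h L (Nat.zero_le N)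
    (by rw [ha.zero, Nat.cast_zero, zero_div]; exact hchain) hL
  obtain ⟨L', hlen, hchain', hL', hclose⟩ := this
  rw [ha.zero, hb.zero] at hclose
  rw [hb.zero] at hchain'
  simp only [Nat.cast_zero, zero_div] at hchain' hclose
  exact ⟨L', hlen, ⟨hchain', hL'⟩, hclose⟩

lemma ShortcutClose.refl (hr : 0 ≤ r) {n : ℕ} (v : Fin (n+1) → EuclideanSpace ℝ (Fin d)) :
    ShortcutClose r v v := fun L hL =>
  ⟨L, rfl, hL, FrechetClose.of_norm_sub_le fun _ _ => by simpa using hr⟩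

lemma ShortcutClose.frechetClose {n : ℕ} {v w : Fin (n+1) → EuclideanSpace ℝ (Fin d)}
    (h : ShortcutClose r v w) : FrechetClose r (polyCurve v) (polyCurve w) := by
  obtain ⟨L', hlen, -, hclose⟩ := h [] (validShortcuts_nil n)
  obtain rfl := List.length_eq_zero_iff.1 hlen
  simpa only [shortcutFrom, subcurve_zero_one] using hclose

lemma simplVerts_of_zero (v : Fin (0+1) → EuclideanSpace ℝ (Fin d)) (μ : ℝ) :
    simplVerts v μ = v := by
  funext k
  exact congrArg v (Fin.ext (by simp))

lemma shortcutClose_simplVerts {n : ℕ} (v : Fin (n+1) → EuclideanSpace ℝ (Fin d)) {μ : ℝ}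
    (hμ : 0 < μ) : ShortcutClose μ v (simplVerts v μ) ∧ ShortcutClose μ (simplVerts v μ) v := by
  rcases Nat.eq_zero_or_pos n with rfl | hn
  · rw [simplVerts_of_zero]
    exact ⟨ShortcutClose.refl hμ.le v, ShortcutClose.refl hμ.le v⟩
  · exact ⟨ShortcutClose.of_isLatticePath hn (isLatticePath_min n)
        (isLatticePath_simplPos (vtx v) μ n) (norm_vtx_sub_vtx_simplVerts_le v hμ),
      ShortcutClose.of_isLatticePath hn (isLatticePath_simplPos (vtx v) μ n)
        (isLatticePath_min n) fun i => by
          rw [norm_sub_rev]; exact norm_vtx_sub_vtx_simplVerts_le v hμ i⟩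

lemma ShortcutClose.sInf_le {m n : ℕ} {x x' : Fin (m+1) → EuclideanSpace ℝ (Fin d)}
    {y y' : Fin (n+1) → EuclideanSpace ℝ (Fin d)} (hx : ShortcutClose r x' x)
    (hy : ShortcutClose r y y') (P : ℕ → Prop) (hP : P 0) :
    sInf {s | ∃ L : List (ℝ × ℝ), P L.length ∧ ValidShortcuts n L ∧
      s = frechetDist (polyCurve x') (shortcutFrom (polyCurve y') L 0)} ≤
    sInf {s | ∃ L : List (ℝ × ℝ), P L.length ∧ ValidShortcuts n L ∧
      s = frechetDist (polyCurve x) (shortcutFrom (polyCurve y) L 0)} + 2 * r := by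
  rw [← sub_le_iff_le_add]
  refine le_csInf ⟨_, [], hP, validShortcuts_nil n, rfl⟩ ?_
  rintro _ ⟨L, hPL, hL, rfl⟩
  rw [sub_le_iff_le_add]
  obtain ⟨L', hlen, hL', hclose⟩ := hy L hL
  have hbdd : BddBelow {s | ∃ L : List (ℝ × ℝ), P L.length ∧ ValidShortcuts n L ∧
      s = frechetDist (polyCurve x') (shortcutFrom (polyCurve y') L 0)} := by
    refine ⟨0, ?_⟩
    rintro _ ⟨L, _, _, rfl⟩
    exact frechetDist_nonneg _ _
  refine (csInf_le hbdd ⟨L', by rwa [hlen], hL', rfl⟩).trans ?_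
  have hdist := frechetClose_frechetDist (continuous_polyCurve x).continuousOn
    (continuousOn_shortcutFrom (continuous_polyCurve y) L 0)
  have := ((hx.frechetClose.trans hdist).trans hclose).frechetDist_le
  linarith

/-- Simplification approximately preserves the (directed,
vertex-restricted) `k`-shortcut Fréchet distance, up to an additive error of `2μ`;
similarly for the unbounded version. -/
theorem shortcutFrechetDist_simpl {d nX nY : ℕ} (μ : ℝ) (hμ : 0 < μ)
    (x : Fin (nX+1) → EuclideanSpace ℝ (Fin d))
    (y : Fin (nY+1) → EuclideanSpace ℝ (Fin d)) :
    (∀ k : ℕ,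
      shortcutFrechetDist (simpl x μ) (simplVerts y μ) k - 2 * μ ≤
          shortcutFrechetDist (polyCurve x) y k ∧
        shortcutFrechetDist (polyCurve x) y k ≤
          shortcutFrechetDist (simpl x μ) (simplVerts y μ) k + 2 * μ) ∧
    (shortcutFrechetDistUnbounded (simpl x μ) (simplVerts y μ) - 2 * μ ≤
        shortcutFrechetDistUnbounded (polyCurve x) y ∧
      shortcutFrechetDistUnbounded (polyCurve x) y ≤
        shortcutFrechetDistUnbounded (simpl x μ) (simplVerts y μ) + 2 * μ) := by
  obtain ⟨hx, hx'⟩ := shortcutClose_simplVerts x hμ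
  obtain ⟨hy, hy'⟩ := shortcutClose_simplVerts y hμ
  refine ⟨fun k => ⟨?_, ?_⟩, ?_, ?_⟩
  · rw [sub_le_iff_le_add]
    exact hx'.sInf_le hy (· ≤ k) (Nat.zero_le k)
  · exact hx.sInf_le hy' (· ≤ k) (Nat.zero_le k)
  · rw [sub_le_iff_le_add]
    simpa only [true_and, shortcutFrechetDistUnbounded, simpl] using
      hx'.sInf_le hy (fun _ => True) trivial
  · simpa only [true_and, shortcutFrechetDistUnbounded, simpl] using
      hx.sInf_le hy' (fun _ => True) trivial

end Jaywalk
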